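/- Let G be a finite connected nonempty simple graph with no 4-cliques (G.CliqueFree 4), and let Γ = ker ℓ be its Bestvina–Brady group, the kernel of the length homomorphism ℓ : A_G → ℤ. Then every finite-index subgroup of Γ contains a subgroup isomorphic to Γ: for every subgroup H of Γ with finite index in Γ, there exists an injective group homomorphism from Γ into H. -/

import Mathlib

/-- The relator set of the right-angled Artin group of a simple graph `G`:
commutators of pairs of adjacent vertices. -/
def raagRels {V : Type*} (G : SimpleGraph V) : Set (FreeGroup V) :=
  {r | ∃ u v : V, G.Adj u v ∧
    r = FreeGroup.of u * FreeGroup.of v * (FreeGroup.of u)⁻¹ * (FreeGroup.of v)⁻¹}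

/-- The right-angled Artin group of a simple graph `G`. -/
abbrev RAAG {V : Type*} (G : SimpleGraph V) : Type _ :=
  PresentedGroup (raagRels G)

/-- The image `v̄` of a vertex (generator) `v` in the right-angled Artin group. -/
def RAAG.gen {V : Type*} (G : SimpleGraph V) (v : V) : RAAG G :=
  PresentedGroup.of (rels := raagRels G) v


section Hnn
open HNNExtension HNNExtension.NormalWord

variable {K : Type*} [Group K] {A : Subgroup K}

/-- Replace `t^u * g` by `t^(u(m+1)) * φ g`, as a word. -/
def expandLetter (φ : K → K) (u : ℤˣ) (g : K) : ℕ → List (ℤˣ × K) → List (ℤˣ × K)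
  | 0, l => (u, φ g) :: l
  | m + 1, l => (u, 1) :: expandLetter φ u g m l

/-- Replace every letter. -/
def expandWord (φ : K → K) (m : ℕ) : List (ℤˣ × K) → List (ℤˣ × K)
  | [] => []
  | (u, g) :: l => expandLetter φ u g m (expandWord φ m l)

theorem expandLetter_head (φ : K → K) (u : ℤˣ) (g : K) (m : ℕ) (l : List (ℤˣ × K)) :
    ∀ b ∈ (expandLetter φ u g m l).head?, b.1 = u := by
  cases m <;> simp [expandLetter]

theorem expandLetter_chain (φ : K → K) (u : ℤˣ) (g : K) (m : ℕ) (l : List (ℤˣ × K))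
    (h : ((u, φ g) :: l).IsChain (fun a b => a.2 ∈ toSubgroup A A a.1 → a.1 = b.1)) :
    (expandLetter φ u g m l).IsChain (fun a b => a.2 ∈ toSubgroup A A a.1 → a.1 = b.1) := by
  induction m with
  | zero => exact h
  | succ m ih =>
    rw [expandLetter, List.isChain_cons]
    exact ⟨fun b hb _ => (expandLetter_head φ u g m l b hb).symm, ih⟩

theorem mem_toSubgroup_self (u : ℤˣ) (g : K) : g ∈ toSubgroup A A u ↔ g ∈ A := by
  rcases Int.units_eq_one_or u with rfl | rfl <;> simp

theorem expandWord_chain (φ : K → K) (hφ : ∀ g, φ g ∈ A → g ∈ A) (m : ℕ) (l : List (ℤˣ × K))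
    (h : l.IsChain (fun a b => a.2 ∈ toSubgroup A A a.1 → a.1 = b.1)) :
    (expandWord φ m l).IsChain (fun a b => a.2 ∈ toSubgroup A A a.1 → a.1 = b.1) := by
  induction l with
  | nil => simp [expandWord]
  | cons x l ih =>
    obtain ⟨u, g⟩ := x
    rw [List.isChain_cons] at h
    apply expandLetter_chain
    rw [List.isChain_cons]
    refine ⟨?_, ih h.2⟩
    intro b hb hm
    have hg : g ∈ toSubgroup A A u :=
      (mem_toSubgroup_self u g).2 (hφ g ((mem_toSubgroup_self u _).1 hm))
    cases l with
    | nil => simp [expandWord] at hb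
    | cons y l =>
      obtain ⟨u', g'⟩ := y
      have h1 := h.1 (u', g') (by simp) hg
      have h2 := expandLetter_head φ u' g' m _ b hb
      exact h1.trans h2.symm

variable (A) in
/-- The trivial HNN extension over `A`. -/
abbrev TrivHNN := HNNExtension K A A (MulEquiv.refl A)

theorem expandLetter_prod (φ : K → K) (u : ℤˣ) (g : K) (m : ℕ) (l : List (ℤˣ × K)) :
    ((expandLetter φ u g m l).map
      (fun x => (t ^ (x.1 : ℤ) * of x.2 : TrivHNN A))).prod =
    (t ^ (u : ℤ)) ^ (m + 1) * of (φ g) *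
      (l.map (fun x => (t ^ (x.1 : ℤ) * of x.2 : TrivHNN A))).prod := by
  induction m with
  | zero => simp [expandLetter]
  | succ m ih =>
    rw [expandLetter, List.map_cons, List.prod_cons, ih, pow_succ' _ (m + 1)]
    simp [mul_assoc]

theorem expandWord_prod (φ : K →* K) (m : ℕ) (ψ : TrivHNN A →* TrivHNN A)
    (hof : ∀ g, ψ (of g) = of (φ g)) (ht : ψ t = t ^ (m + 1)) (l : List (ℤˣ × K)) :
    ((expandWord φ m l).map
      (fun x => (t ^ (x.1 : ℤ) * of x.2 : TrivHNN A))).prod =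
    ψ ((l.map (fun x => (t ^ (x.1 : ℤ) * of x.2 : TrivHNN A))).prod) := by
  induction l with
  | nil => simp [expandWord]
  | cons x l ih =>
    obtain ⟨u, g⟩ := x
    rw [expandWord, expandLetter_prod, ih]
    simp only [List.map_cons, List.prod_cons, map_mul, map_zpow, hof, ht]
    congr 2
    rw [← zpow_natCast, ← zpow_natCast, ← zpow_mul, ← zpow_mul, mul_comm]

theorem hnn_power_injective (φ : K →* K) (hinj : Function.Injective φ)
    (hφ : ∀ g, φ g ∈ A → g ∈ A) (m : ℕ) (ψ : TrivHNN A →* TrivHNN A)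
    (hof : ∀ g, ψ (of g) = of (φ g)) (ht : ψ t = t ^ (m + 1)) :
    Function.Injective ψ := by
  rw [injective_iff_map_eq_one]
  intro x hx
  obtain ⟨d⟩ := TransversalPair.nonempty K A A
  have hxw := prod_smul_empty (φ := MulEquiv.refl A) (d := d)
    ((NormalWord.equiv (MulEquiv.refl A) d) x)
  obtain ⟨w, rfl⟩ : ∃ w : NormalWord d, w.toReducedWord.prod (MulEquiv.refl A) = x :=
    ⟨NormalWord.equiv (MulEquiv.refl A) d x,
      (NormalWord.equiv (MulEquiv.refl A) d).symm_apply_apply x⟩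
  let w' : ReducedWord K A A := ⟨φ w.head, expandWord φ m w.toList,
    expandWord_chain φ hφ m _ w.chain⟩
  have hw' : w'.prod (MulEquiv.refl A) = 1 := by
    rw [← hx]
    simp only [ReducedWord.prod, w', map_mul, hof]
    rw [expandWord_prod φ m ψ hof ht]
  have hnil : w'.toList = [] :=
    ReducedWord.toList_eq_nil_of_mem_of_range _ w' (by rw [hw']; exact one_mem _)
  have hl : w.toList = [] := by
    have h0 : expandWord φ m w.toList = [] := hnil
    cases hc : w.toList with
    | nil => rfl
    | cons y l =>
      obtain ⟨u, g⟩ := y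
      rw [hc, expandWord] at h0
      cases m <;> simp [expandLetter] at h0
  simp only [ReducedWord.prod, hl, List.map_nil, List.prod_nil, mul_one, hof] at hx ⊢
  have h1 : φ w.head = 1 := of_injective (φ := MulEquiv.refl A) (by rw [hx, map_one])
  rw [hinj (h1.trans (map_one φ).symm), map_one]

end Hnn

section Raag

variable {V : Type*} {G : SimpleGraph V}

theorem raag_comm {u v : V} (h : G.Adj u v) : Commute (RAAG.gen G u) (RAAG.gen G v) := by
  have h1 : PresentedGroup.mk (raagRels G) (FreeGroup.of u * FreeGroup.of v *
      (FreeGroup.of u)⁻¹ * (FreeGroup.of v)⁻¹) = 1 :=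
    PresentedGroup.one_of_mem ⟨u, v, h, rfl⟩
  simp only [map_mul, map_inv] at h1
  rw [mul_inv_eq_one, mul_inv_eq_iff_eq_mul] at h1
  exact h1

theorem raag_lift_rel {M : Type*} [Group M] (f : V → M)
    (hf : ∀ u v, G.Adj u v → Commute (f u) (f v)) :
    ∀ r ∈ raagRels G, FreeGroup.lift f r = 1 := by
  rintro r ⟨u, v, h, rfl⟩
  simp [(hf u v h).eq]

/-- Universal property of the RAAG. -/
def raagLift {M : Type*} [Group M] (f : V → M)
    (hf : ∀ u v, G.Adj u v → Commute (f u) (f v)) : RAAG G →* M :=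
  PresentedGroup.toGroup (raag_lift_rel f hf)

theorem raagLift_gen {M : Type*} [Group M] (f : V → M)
    (hf : ∀ u v, G.Adj u v → Commute (f u) (f v)) (v : V) :
    raagLift f hf (RAAG.gen G v) = f v :=
  PresentedGroup.toGroup.of _

theorem raag_hom_ext {M : Type*} [Group M] {f g : RAAG G →* M}
    (h : ∀ v, f (RAAG.gen G v) = g (RAAG.gen G v)) : f = g :=
  PresentedGroup.ext h

variable (G) in
/-- The power endomorphism. -/
def raagPow (n : ℕ) : RAAG G →* RAAG G :=
  raagLift (fun v => RAAG.gen G v ^ n) (fun _ _ h => (raag_comm h).pow_pow n n)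

theorem raagPow_gen (n : ℕ) (v : V) : raagPow G n (RAAG.gen G v) = RAAG.gen G v ^ n :=
  raagLift_gen _ _ _

variable (G) in
open Classical in
/-- Retraction on the subgroup generated by the vertices in `S`. -/
noncomputable def raagRetr (S : Set V) : RAAG G →* RAAG G :=
  raagLift (fun v => if v ∈ S then RAAG.gen G v else 1) (fun u v h => by
    split_ifs
    · exact raag_comm h
    · exact Commute.one_right _
    · exact Commute.one_left _
    · exact Commute.one_left _)

variable (G) in
/-- Subgroup generated by the vertices in `S`. -/
def raagSub (S : Set V) : Subgroup (RAAG G) := Subgroup.closure (RAAG.gen G '' S)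

theorem raag_induction {P : Subgroup (RAAG G)} (h : ∀ v, RAAG.gen G v ∈ P) (g : RAAG G) :
    g ∈ P := by
  have : (⊤ : Subgroup (RAAG G)) ≤ P := by
    rw [← PresentedGroup.closure_range_of, Subgroup.closure_le]
    rintro _ ⟨v, rfl⟩
    exact h v
  exact this trivial

theorem raagRetr_mem (S : Set V) (g : RAAG G) : raagRetr G S g ∈ raagSub G S := by
  refine raag_induction (P := (raagSub G S).comap (raagRetr G S)) ?_ g
  intro v
  change raagRetr G S (RAAG.gen G v) ∈ raagSub G S
  rw [raagRetr, raagLift_gen]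
  split_ifs with h
  · exact Subgroup.subset_closure ⟨v, h, rfl⟩
  · exact one_mem _

theorem raagRetr_fix (S : Set V) {g : RAAG G} (hg : g ∈ raagSub G S) : raagRetr G S g = g := by
  have : raagSub G S ≤ (raagRetr G S).eqLocus (MonoidHom.id _) := by
    rw [raagSub, Subgroup.closure_le]
    rintro _ ⟨v, hv, rfl⟩
    change raagRetr G S (RAAG.gen G v) = RAAG.gen G v
    rw [raagRetr, raagLift_gen, if_pos hv]
  exact this hg

theorem raagRetr_pow (S : Set V) (n : ℕ) (g : RAAG G) :
    raagRetr G S (raagPow G n g) = raagPow G n (raagRetr G S g) := by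
  have : (raagRetr G S).comp (raagPow G n) = (raagPow G n).comp (raagRetr G S) := by
    apply raag_hom_ext
    intro v
    simp only [MonoidHom.comp_apply, raagPow_gen, map_pow]
    rw [raagRetr, raagLift_gen]
    split_ifs
    · rw [raagPow_gen]
    · simp
  exact DFunLike.congr_fun this g

theorem raagPow_mem (S : Set V) (n : ℕ) (hinj : Function.Injective (raagPow G n)) (g : RAAG G)
    (hg : raagPow G n g ∈ raagSub G S) : g ∈ raagSub G S := by
  have h1 := raagRetr_fix S hg
  rw [raagRetr_pow] at h1
  rw [← hinj h1]
  exact raagRetr_mem S g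

theorem commute_of_mem_closure {M N : Type*} [Group M] [Group N] {S : Set M} (f : M →* N) (x : N)
    (h : ∀ s ∈ S, Commute x (f s)) {a : M} (ha : a ∈ Subgroup.closure S) : Commute x (f a) := by
  have : Subgroup.closure S ≤ (Subgroup.centralizer {x}).comap f := by
    rw [Subgroup.closure_le]
    intro s hs
    change f s ∈ Subgroup.centralizer {x}
    rw [Subgroup.mem_centralizer_singleton_iff]
    exact (h s hs).symm.eq
  have h2 : f a ∈ Subgroup.centralizer {x} := this ha
  rw [Subgroup.mem_centralizer_singleton_iff] at h2
  exact Commute.symm h2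

theorem raagPow_injective_option {W : Type*} (G : SimpleGraph (Option W)) (m : ℕ)
    (ih : Function.Injective (raagPow (G.comap some) (m + 1))) :
    Function.Injective (raagPow G (m + 1)) := by
  let G' := G.comap (some : W → Option W)
  let S : Set W := {w | G.Adj none (some w)}
  let A := raagSub G' S
  let tt : TrivHNN A := HNNExtension.t
  let oo : RAAG G' →* TrivHNN A := HNNExtension.of
  have hto : ∀ a ∈ A, Commute tt (oo a) := fun a ha =>
    HNNExtension.t_mul_of (φ := MulEquiv.refl A) ⟨a, ha⟩
  have hS : ∀ w, G.Adj none (some w) → Commute tt (oo (RAAG.gen G' w)) := fun w hw =>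
    hto _ (Subgroup.subset_closure ⟨w, hw, rfl⟩)
  let F : RAAG G →* TrivHNN A :=
    raagLift (fun v => Option.elim v tt (fun w => oo (RAAG.gen G' w))) (by
      rintro (_ | u) (_ | v) h
      · exact Commute.refl _
      · exact hS _ h
      · exact (hS _ h.symm).symm
      · have h' : G'.Adj u v := h
        exact (raag_comm h').map oo)
  have Fnone : F (RAAG.gen G none) = tt := raagLift_gen _ _ _
  have Fsome : ∀ w, F (RAAG.gen G (some w)) = oo (RAAG.gen G' w) := fun w => raagLift_gen _ _ _
  let j : RAAG G' →* RAAG G := raagLift (fun w => RAAG.gen G (some w)) (fun u v h => raag_comm h)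
  have hj : ∀ w, j (RAAG.gen G' w) = RAAG.gen G (some w) := fun w => raagLift_gen _ _ _
  let B : TrivHNN A →* RAAG G := HNNExtension.lift j (RAAG.gen G none) (by
    intro a
    refine commute_of_mem_closure j _ ?_ a.2
    rintro _ ⟨w, hw, rfl⟩
    rw [hj]
    exact raag_comm hw)
  have hBF : B.comp F = MonoidHom.id _ := by
    apply raag_hom_ext
    rintro (_ | w)
    · rw [MonoidHom.comp_apply, Fnone]
      exact HNNExtension.lift_t _ _ _
    · rw [MonoidHom.comp_apply, Fsome]
      exact (HNNExtension.lift_of _ _ _ _).trans (hj w)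
  have hF : Function.Injective F := by
    intro x y hxy
    have h1 := DFunLike.congr_fun hBF x
    have h2 := DFunLike.congr_fun hBF y
    simp only [MonoidHom.comp_apply, MonoidHom.id_apply] at h1 h2
    rw [← h1, ← h2, hxy]
  let φ := raagPow G' (m + 1)
  have hφA : ∀ a ∈ A, φ a ∈ A := by
    have : A ≤ A.comap φ := by
      refine (Subgroup.closure_le _).2 ?_
      rintro _ ⟨w, hw, rfl⟩
      change φ (RAAG.gen G' w) ∈ A
      rw [raagPow_gen]
      have hw' : RAAG.gen G' w ∈ A := Subgroup.subset_closure ⟨w, hw, rfl⟩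
      exact pow_mem hw' _
    exact this
  let ψ : TrivHNN A →* TrivHNN A := HNNExtension.lift (oo.comp φ) (tt ^ (m + 1)) (by
    intro a
    exact (hto _ (hφA a a.2)).pow_left (m + 1))
  have hof : ∀ g, ψ (HNNExtension.of g) = HNNExtension.of (φ g) :=
    fun g => HNNExtension.lift_of _ _ _ _
  have ht : ψ HNNExtension.t = HNNExtension.t ^ (m + 1) := HNNExtension.lift_t _ _ _
  have hψ : Function.Injective ψ :=
    hnn_power_injective φ ih (raagPow_mem S (m + 1) ih) m ψ hof ht
  have hcomm : F.comp (raagPow G (m + 1)) = ψ.comp F := by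
    apply raag_hom_ext
    rintro (_ | w)
    · rw [MonoidHom.comp_apply, MonoidHom.comp_apply, raagPow_gen, map_pow, Fnone]
      exact ht.symm
    · rw [MonoidHom.comp_apply, MonoidHom.comp_apply, raagPow_gen, map_pow, Fsome]
      refine Eq.trans ?_ (hof _).symm
      rw [raagPow_gen, map_pow]
  have h3 : Function.Injective (F.comp (raagPow G (m + 1))) := by
    rw [hcomm]
    exact hψ.comp hF
  exact Function.Injective.of_comp (f := F) h3

theorem raagPow_injective_equiv {W : Type*} (e : V ≃ W) (G : SimpleGraph W) (n : ℕ)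
    (ih : Function.Injective (raagPow (G.comap e) n)) : Function.Injective (raagPow G n) := by
  let F : RAAG G →* RAAG (G.comap e) := raagLift (fun w => RAAG.gen _ (e.symm w)) (by
    intro u v h
    apply raag_comm
    simpa using h)
  let B : RAAG (G.comap e) →* RAAG G := raagLift (fun v => RAAG.gen _ (e v))
    (fun u v h => raag_comm h)
  have hFg : ∀ w, F (RAAG.gen G w) = RAAG.gen _ (e.symm w) := fun w => raagLift_gen _ _ _
  have hBg : ∀ w, B (RAAG.gen _ w) = RAAG.gen G (e w) := fun w => raagLift_gen _ _ _
  have hBF : B.comp F = MonoidHom.id _ := by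
    apply raag_hom_ext
    intro w
    simp [hFg, hBg]
  have hF : Function.Injective F := by
    intro x y hxy
    have h1 := DFunLike.congr_fun hBF x
    have h2 := DFunLike.congr_fun hBF y
    simp only [MonoidHom.comp_apply, MonoidHom.id_apply] at h1 h2
    rw [← h1, ← h2, hxy]
  have hcomm : F.comp (raagPow G n) = (raagPow (G.comap e) n).comp F := by
    apply raag_hom_ext
    intro w
    simp [hFg, raagPow_gen]
  have h3 : Function.Injective (F.comp (raagPow G n)) := by
    rw [hcomm]
    exact ih.comp hF
  exact Function.Injective.of_comp (f := F) h3

theorem raagPow_injective {V : Type*} [Finite V] (G : SimpleGraph V) (m : ℕ) :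
    Function.Injective (raagPow G (m + 1)) := by
  refine Finite.induction_empty_option
    (P := fun V => ∀ G : SimpleGraph V, Function.Injective (raagPow G (m + 1))) ?_ ?_ ?_ V G
  · intro α β e h G
    exact raagPow_injective_equiv e G _ (h _)
  · intro G
    have : raagPow G (m + 1) = MonoidHom.id _ := raag_hom_ext (fun v => v.elim)
    rw [this]
    exact Function.injective_id
  · intro α _ h G
    exact raagPow_injective_option G m (h _)

variable (G) in
/-- The subgroup generated by the edge elements. -/
def edgeSub : Subgroup (RAAG G) :=
  Subgroup.closure {x | ∃ u v, G.Adj u v ∧ x = RAAG.gen G u * (RAAG.gen G v)⁻¹}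

theorem edgeSub_edge {u v : V} (h : G.Adj u v) :
    RAAG.gen G u * (RAAG.gen G v)⁻¹ ∈ edgeSub G :=
  Subgroup.subset_closure ⟨u, v, h, rfl⟩

theorem edgeSub_pair (hc : G.Connected) (u v : V) :
    RAAG.gen G u * (RAAG.gen G v)⁻¹ ∈ edgeSub G := by
  obtain ⟨p⟩ := hc.preconnected u v
  induction p with
  | nil => simp
  | cons h p ih =>
    have := mul_mem (edgeSub_edge h) ih
    simpa using this

theorem edgeSub_pair' (hc : G.Connected) (u v : V) :
    (RAAG.gen G u)⁻¹ * RAAG.gen G v ∈ edgeSub G := by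
  obtain ⟨p⟩ := hc.preconnected u v
  induction p with
  | nil => simp
  | cons h p ih =>
    have h1 := edgeSub_edge h.symm
    rw [(raag_comm h.symm).inv_right.eq] at h1
    have := mul_mem h1 ih
    simpa using this

theorem edgeSub_conj (hc : G.Connected) (v : V) :
    RAAG.gen G v ∈ Subgroup.normalizer (edgeSub G : Set (RAAG G)) := by
  have key : ∀ u w, G.Adj u w →
      RAAG.gen G v * (RAAG.gen G u * (RAAG.gen G w)⁻¹) * (RAAG.gen G v)⁻¹ ∈ edgeSub G ∧
      (RAAG.gen G v)⁻¹ * (RAAG.gen G u * (RAAG.gen G w)⁻¹) * RAAG.gen G v ∈ edgeSub G := by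
    intro u w h
    have he : RAAG.gen G u * (RAAG.gen G w)⁻¹ ∈ edgeSub G := edgeSub_edge h
    have hcu : Commute (RAAG.gen G u) (RAAG.gen G u * (RAAG.gen G w)⁻¹) :=
      (Commute.refl _).mul_right (raag_comm h).inv_right
    generalize RAAG.gen G u * (RAAG.gen G w)⁻¹ = x at he hcu
    constructor
    · have hk := edgeSub_pair hc v u
      generalize hkk : RAAG.gen G v * (RAAG.gen G u)⁻¹ = k at hk
      have hv : RAAG.gen G v = k * RAAG.gen G u := by rw [← hkk]; group
      have : RAAG.gen G v * x * (RAAG.gen G v)⁻¹ = k * x * k⁻¹ := by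
        rw [hv, mul_assoc k, hcu.eq]; group
      rw [this]
      exact mul_mem (mul_mem hk he) (inv_mem hk)
    · have hk := edgeSub_pair' hc u v
      generalize hkk : (RAAG.gen G u)⁻¹ * RAAG.gen G v = k at hk
      have hv : RAAG.gen G v = RAAG.gen G u * k := by rw [← hkk]; group
      have : (RAAG.gen G v)⁻¹ * x * RAAG.gen G v = k⁻¹ * x * k := by
        rw [hv, mul_assoc, ← mul_assoc x, ← hcu.eq]; group
      rw [this]
      exact mul_mem (mul_mem (inv_mem hk) he) hk
  have h1 : edgeSub G ≤ (edgeSub G).comap (MulAut.conj (RAAG.gen G v)).toMonoidHom := by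
    refine (Subgroup.closure_le _).2 ?_
    rintro _ ⟨u, w, h, rfl⟩
    exact (key u w h).1
  have h2 : edgeSub G ≤ (edgeSub G).comap (MulAut.conj (RAAG.gen G v)⁻¹).toMonoidHom := by
    refine (Subgroup.closure_le _).2 ?_
    rintro _ ⟨u, w, h, rfl⟩
    have := (key u w h).2
    simpa using this
  rw [Subgroup.mem_normalizer_iff]
  intro x
  refine ⟨fun hx => h1 hx, fun hx => ?_⟩
  have := h2 hx
  simpa [mul_assoc] using this

theorem edgeSub_normal (hc : G.Connected) : (edgeSub G).Normal := by
  rw [← Subgroup.normalizer_eq_top_iff, eq_top_iff]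
  intro g _
  exact raag_induction (edgeSub_conj hc) g

theorem ker_le_edgeSub (hc : G.Connected) (ℓ : RAAG G →* Multiplicative ℤ)
    (hℓ : ∀ v : V, ℓ (RAAG.gen G v) = Multiplicative.ofAdd 1) : ℓ.ker ≤ edgeSub G := by
  haveI := edgeSub_normal hc
  obtain ⟨v₀⟩ := hc.nonempty
  let q := QuotientGroup.mk' (edgeSub G)
  have hq : q = (zpowersHom _ (q (RAAG.gen G v₀))).comp ℓ := by
    apply raag_hom_ext
    intro v
    rw [MonoidHom.comp_apply, hℓ, zpowersHom_apply, toAdd_ofAdd, zpow_one]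
    exact (QuotientGroup.eq).2 (edgeSub_pair' hc v v₀)
  intro g hg
  have h1 : q g = 1 := by
    rw [hq, MonoidHom.comp_apply, MonoidHom.mem_ker.1 hg, map_one]
  exact (QuotientGroup.eq_one_iff g).1 h1

end Raag

theorem stmt_14 {V : Type*} [Finite V] [Nonempty V] (G : SimpleGraph V)
    (hconn : G.Connected) (hcf : G.CliqueFree 4)
    (ℓ : RAAG G →* Multiplicative ℤ)
    (hℓ : ∀ v : V, ℓ (RAAG.gen G v) = Multiplicative.ofAdd 1)
    (H : Subgroup ℓ.ker) (hH : H.FiniteIndex) :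
    ∃ f : ℓ.ker →* H, Function.Injective f := by
  obtain ⟨m, hm⟩ : ∃ m, m + 1 = H.index.factorial :=
    ⟨H.index.factorial - 1, Nat.sub_add_cancel (Nat.factorial_pos _)⟩
  have hle : edgeSub G ≤ (H.map ℓ.ker.subtype).comap (raagPow G (m + 1)) := by
    refine (Subgroup.closure_le _).2 ?_
    rintro _ ⟨u, v, h, rfl⟩
    have hk : RAAG.gen G u * (RAAG.gen G v)⁻¹ ∈ ℓ.ker := by
      rw [MonoidHom.mem_ker, map_mul, map_inv, hℓ, hℓ, mul_inv_cancel]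
    have hp := Subgroup.pow_mem_of_index_ne_zero_of_dvd hH.index_ne_zero
      (⟨_, hk⟩ : ℓ.ker) (n := m + 1) (fun k hk0 hk1 => hm ▸ Nat.dvd_factorial hk0 hk1)
    refine ⟨_, hp, ?_⟩
    simp only [map_mul, map_inv, raagPow_gen, map_pow, Subgroup.subtype_apply]
    rw [(raag_comm h).inv_right.mul_pow, inv_pow]
  have hmem : ∀ g : ℓ.ker, ∃ x : H, ((x : ℓ.ker) : RAAG G) = raagPow G (m + 1) g := by
    intro g
    obtain ⟨x, hx, hxe⟩ := hle (ker_le_edgeSub hconn ℓ hℓ g.2)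
    exact ⟨⟨x, hx⟩, hxe⟩
  choose f hf using hmem
  refine ⟨MonoidHom.mk' f ?_, ?_⟩
  · intro a b
    apply Subtype.ext
    apply Subtype.ext
    simp [hf]
  · intro a b hab
    apply Subtype.ext
    apply raagPow_injective G m
    rw [← hf, ← hf]
    exact congrArg (fun x : H => ((x : ℓ.ker) : RAAG G)) hab
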